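/- arXiv:2209.08170 — 3 statements merged into one kernel-verified Lean document; each statement's English description precedes it below -/
import Mathlib

section
/- Let c, M, r be positive natural numbers, ε > 0 a real number, and α : ℝ → ℝ a locally Lipschitz, strictly increasing function with α(0) = 0 (a class K∞ function). Suppose p : ℝ → (Fin c → ℝ), L : ℝ → Matrix (Fin c) (Fin M) ℝ, and N : ℝ → Matrix (Fin c) (Fin r) ℝ are such that for every t ≥ 0: (N t)ᵀ ⬝ (N t) = 1 (the columns of N t are orthonormal) and the column span of N t equals the kernel of the linear map v ↦ (L t)ᵀ *ᵥ v from ℝ^c to ℝ^M. Define h_p : ℝ → ℝ by h_p(t) = (1/2) ⟪p t, (1 − (N t) ⬝ (N t)ᵀ) *ᵥ (p t)⟫ − ε. If h_p is differentiable on [0, ∞), h_p(0) ≥ 0, and h_p′(t) ≥ −α(h_p(t)) for all t ≥ 0, then (L t)ᵀ *ᵥ (p t) ≠ 0 for all t ≥ 0 (equivalently, the row vector (p t)ᵀ ⬝ (L t) is nonzero for all t ≥ 0). -/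
open Matrix

/-- The Euclidean norm on `Fin c → ℝ` (via the `L²` structure). -/
noncomputable def euclideanNorm {c : ℕ} (v : Fin c → ℝ) : ℝ :=
  ‖(WithLp.equiv 2 (Fin c → ℝ)).symm v‖

/-- A differentiable function on `[0, ∞)` that starts nonnegative and whose derivative is positive
wherever it is negative stays nonnegative. -/
theorem nonneg_of_deriv_pos_of_neg {f : ℝ → ℝ} (hf : DifferentiableOn ℝ f (Set.Ici 0))
    (hf_zero : 0 ≤ f 0) (hf_deriv : ∀ t > 0, f t < 0 → 0 < deriv f t) {t : ℝ} (ht : 0 ≤ t) :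
    0 ≤ f t := by
  by_contra! hneg
  obtain ⟨m, hm, hmin⟩ := isCompact_Icc.exists_isMinOn (Set.nonempty_Icc.2 ht)
    (hf.continuousOn.mono Set.Icc_subset_Ici_self)
  have hfm : f m < 0 := (hmin (Set.right_mem_Icc.2 ht)).trans_lt hneg
  have hm_pos : 0 < m := hm.1.lt_of_ne' (by rintro rfl; exact hfm.not_ge hf_zero)
  have hderiv : HasDerivAt f (deriv f m) m :=
    (hf.differentiableAt (Ici_mem_nhds hm_pos)).hasDerivAt
  have hslope := (hasDerivAt_iff_tendsto_slope.1 hderiv).mono_left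
    (nhdsWithin_mono m (s := Set.Iio m) fun _ hx => ne_of_lt hx)
  obtain ⟨x, hx_slope, hx⟩ := ((hslope.eventually (lt_mem_nhds (hf_deriv m hm_pos hfm))).and
    (Ioo_mem_nhdsLT hm_pos)).exists
  rw [slope_def_field] at hx_slope
  have hle : f m ≤ f x := hmin ⟨hx.1.le, hx.2.le.trans hm.2⟩
  exact hx_slope.not_ge (div_nonpos_of_nonneg_of_nonpos (sub_nonneg.2 hle) (sub_nonpos.2 hx.2.le))

/-- If `N` has orthonormal columns, then `1 - N Nᵀ` annihilates the column span of `N`. -/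
theorem one_sub_mul_transpose_mulVec_eq_zero {m n : Type*} [Fintype m] [DecidableEq m]
    [Fintype n] [DecidableEq n] {N : Matrix m n ℝ} (hN : Nᵀ * N = 1) {v : m → ℝ}
    (hv : v ∈ Submodule.span ℝ (Set.range N.col)) : (1 - N * Nᵀ) *ᵥ v = 0 := by
  rw [← Matrix.range_mulVecLin] at hv
  obtain ⟨w, rfl⟩ := hv
  rw [Matrix.mulVecLin_apply, Matrix.mulVec_mulVec, Matrix.sub_mul, Matrix.mul_assoc, hN]
  simp

/-- If the barrier condition on
`h_p(t) = ½ ⟪p t, (I − N Nᵀ) p t⟫ − ε` holds along time (with `N t` an orthonormal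
basis matrix of the kernel of `(L t)ᵀ`), and `h_p(0) ≥ 0`, then `(L t)ᵀ (p t) ≠ 0`
for all `t ≥ 0`. -/
theorem stmt_0 (c M r : ℕ) (hc : 0 < c) (hM : 0 < M) (hr : 0 < r)
    (ε : ℝ) (hε : 0 < ε)
    (α : ℝ → ℝ) (hα_lip : LocallyLipschitz α) (hα_mono : StrictMono α) (hα_zero : α 0 = 0)
    (p : ℝ → (Fin c → ℝ))
    (L : ℝ → Matrix (Fin c) (Fin M) ℝ)
    (N : ℝ → Matrix (Fin c) (Fin r) ℝ)
    (hN_orth : ∀ t ≥ (0 : ℝ), (N t)ᵀ * (N t) = 1)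
    (hN_span : ∀ t ≥ (0 : ℝ),
      Submodule.span ℝ (Set.range (N t)ᵀ) = LinearMap.ker ((L t)ᵀ.mulVecLin))
    (h_p : ℝ → ℝ)
    (h_p_def : ∀ t, h_p t = (1 / 2) * (p t ⬝ᵥ ((1 - N t * (N t)ᵀ) *ᵥ p t)) - ε)
    (h_p_diff : DifferentiableOn ℝ h_p (Set.Ici 0))
    (h_p_zero : 0 ≤ h_p 0)
    (h_p_ineq : ∀ t ≥ (0 : ℝ), deriv h_p t ≥ -α (h_p t)) :
    ∀ t ≥ (0 : ℝ), (L t)ᵀ *ᵥ p t ≠ 0 := by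
  intro t ht hzero
  have h_nonneg : 0 ≤ h_p t := by
    refine nonneg_of_deriv_pos_of_neg h_p_diff h_p_zero (fun s hs hneg => ?_) ht
    have hα_neg : α (h_p s) < 0 := hα_zero ▸ hα_mono hneg
    linarith [h_p_ineq s hs.le]
  have hp_mem : p t ∈ Submodule.span ℝ (Set.range (N t).col) :=
    (hN_span t ht).ge hzero
  rw [h_p_def, one_sub_mul_transpose_mulVec_eq_zero (hN_orth t ht) hp_mem, dotProduct_zero]
    at h_nonneg
  linarith
end

section
/- Let c ≥ 2 be a natural number, and let v : Fin c → ℝ and k : Fin c → ℝ with k s > 0 for all s. If 1 − ∑_{s} Real.exp(−(k s) * (v s)) ≥ 0, then v s > 0 for every s. Equivalently: if v s ≤ 0 for some s, then 1 − ∑_{s} Real.exp(−(k s) * (v s)) < 0. -/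
/-- For `c ≥ 2` and positive gains `k`, nonnegativity of the
consolidated barrier value `1 − ∑ s, exp(−k s · v s)` forces every constituent
value `v s` to be strictly positive; equivalently, if some `v s ≤ 0` then the
consolidated value is negative. -/
theorem stmt_4 (c : ℕ) (hc : 2 ≤ c) (v k : Fin c → ℝ) (hk : ∀ s, 0 < k s) :
    ((1 - ∑ s, Real.exp (-(k s) * (v s)) ≥ 0) → ∀ s, 0 < v s) ∧
    ((∃ s, v s ≤ 0) → 1 - ∑ s, Real.exp (-(k s) * (v s)) < 0) := by
  have key : (∃ s, v s ≤ 0) → 1 - ∑ s, Real.exp (-(k s) * (v s)) < 0 := by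
    rintro ⟨s, hs⟩
    have : Nontrivial (Fin c) := Fin.nontrivial_iff_two_le.mpr hc
    obtain ⟨t, hts⟩ := exists_ne s
    have hone : 1 ≤ Real.exp (-(k s) * (v s)) :=
      Real.one_le_exp (mul_nonneg_of_nonpos_of_nonpos (neg_nonpos.mpr (hk s).le) hs)
    have hlt : Real.exp (-(k s) * (v s)) < ∑ s, Real.exp (-(k s) * (v s)) :=
      Finset.single_lt_sum (f := fun s => Real.exp (-(k s) * (v s))) hts (Finset.mem_univ s)
        (Finset.mem_univ t) (Real.exp_pos _)
        fun _ _ _ => (Real.exp_pos _).le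
    linarith
  refine ⟨fun h s => ?_, key⟩
  by_contra hs
  exact (key ⟨s, not_lt.mp hs⟩).not_ge h
end

section
/- Let X be a set, c ≥ 2 a natural number, h : Fin c → (X → ℝ), and define for k : Fin c → ℝ the set C(k) = {x ∈ X : 1 − ∑_{s} Real.exp(−(k s) * (h s x)) ≥ 0}. If k, k' : Fin c → ℝ satisfy 0 < k s ≤ k' s for all s, then C(k) ⊆ C(k'). -/
/-- Monotonicity of the consolidated-CBF superlevel set in the
gains: for `c ≥ 2`, if `0 < k s ≤ k' s` for all `s`, then
`C(k) = {x | 1 − ∑ s, exp(−k s · h s x) ≥ 0}` is contained in `C(k')`. -/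
theorem stmt_6 (X : Type*) (c : ℕ) (hc : 2 ≤ c) (h : Fin c → X → ℝ)
    (C : (Fin c → ℝ) → Set X)
    (hC : ∀ k, C k = {x : X | 1 - ∑ s, Real.exp (-(k s) * (h s x)) ≥ 0})
    (k k' : Fin c → ℝ) (hk : ∀ s, 0 < k s) (hkk' : ∀ s, k s ≤ k' s) :
    C k ⊆ C k' := by
  intro x hx
  simp only [hC, Set.mem_ofPred_eq, ge_iff_le, sub_nonneg] at hx ⊢
  refine le_trans (Finset.sum_le_sum fun s _ => ?_) hx
  have hterm : Real.exp (-(k s) * h s x) ≤ 1 :=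
    (Finset.single_le_sum (f := fun s => Real.exp (-(k s) * h s x))
      (fun _ _ => (Real.exp_pos _).le) (Finset.mem_univ s)).trans hx
  have hnonneg : 0 ≤ h s x := by
    rw [Real.exp_le_one_iff, neg_mul, neg_nonpos] at hterm
    exact nonneg_of_mul_nonneg_right hterm (hk s)
  exact Real.exp_le_exp.mpr
    (mul_le_mul_of_nonneg_right (neg_le_neg (hkk' s)) hnonneg)
end
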